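/- arXiv:math/0507028 — 2 statements merged into one kernel-verified Lean document; each statement's English description precedes it below -/
import Mathlib

section
/- Let H be a complex Hénon map of degree d. For every (z,w) ∈ ℂ², the limits G⁺(z,w) = lim_{n→∞} d⁻ⁿ log⁺‖Hⁿ(z,w)‖ and G⁻(z,w) = lim_{n→∞} d⁻ⁿ log⁺‖H⁻ⁿ(z,w)‖ exist, and the resulting functions G⁺, G⁻ : ℂ² → ℝ are continuous. -/
open Filter Metric Topology Set

noncomputable section

/-- An elementary Hénon map `(z,w) ↦ (P(z) + a·w, b·z)` with `deg P ≥ 2`, `a ≠ 0`, `b ≠ 0`. -/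
structure ElemHenon where
  P : Polynomial ℂ
  a : ℂ
  b : ℂ
  ha : a ≠ 0
  hb : b ≠ 0
  hdeg : 2 ≤ P.natDegree

def ElemHenon.toFun (h : ElemHenon) : ℂ × ℂ → ℂ × ℂ :=
  fun p => (h.P.eval p.1 + h.a * p.2, h.b * p.1)

def ElemHenon.invFun (h : ElemHenon) : ℂ × ℂ → ℂ × ℂ :=
  fun p => (p.2 / h.b, (p.1 - h.P.eval (p.2 / h.b)) / h.a)

/-- A complex Hénon map: a nonempty composition `H = H₁ ∘ ⋯ ∘ Hₙ` of elementary Hénon maps. -/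
structure HenonMap where
  comps : List ElemHenon
  ne : comps ≠ []

/-- The map `H = H₁ ∘ ⋯ ∘ Hₙ`. -/
def HenonMap.toFun (H : HenonMap) : ℂ × ℂ → ℂ × ℂ :=
  H.comps.foldr (fun h f => h.toFun ∘ f) id

/-- The inverse map `H⁻¹ = Hₙ⁻¹ ∘ ⋯ ∘ H₁⁻¹`. -/
def HenonMap.invFun (H : HenonMap) : ℂ × ℂ → ℂ × ℂ :=
  H.comps.foldl (fun f h => h.invFun ∘ f) id

/-- The degree `d = ∏ deg Pᵢ`. -/
def HenonMap.deg (H : HenonMap) : ℕ :=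
  (H.comps.map fun h => h.P.natDegree).prod

/-- The (constant) Jacobian determinant of `H`; each factor contributes `-aᵢbᵢ`. -/
def HenonMap.jacDet (H : HenonMap) : ℂ :=
  (H.comps.map fun h => -(h.a * h.b)).prod

/-- Points with bounded forward orbit. -/
def Kplus (H : HenonMap) : Set (ℂ × ℂ) :=
  {p | Bornology.IsBounded (Set.range fun n : ℕ => H.toFun^[n] p)}

/-- Points with bounded backward orbit. -/
def Kminus (H : HenonMap) : Set (ℂ × ℂ) :=
  {p | Bornology.IsBounded (Set.range fun n : ℕ => H.invFun^[n] p)}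

def Jplus (H : HenonMap) : Set (ℂ × ℂ) := frontier (Kplus H)

def Jminus (H : HenonMap) : Set (ℂ × ℂ) := frontier (Kminus H)

/-- The Julia set `J = J⁺ ∩ J⁻`. -/
def Jset (H : HenonMap) : Set (ℂ × ℂ) := Jplus H ∩ Jminus H

/-- The forward escape function `G⁺(p) = lim d⁻ⁿ log⁺ ‖Hⁿ(p)‖`. -/
def Gplus (H : HenonMap) (p : ℂ × ℂ) : ℝ :=
  limUnder atTop fun n : ℕ => Real.log (max ‖H.toFun^[n] p‖ 1) / (H.deg : ℝ) ^ n

/-- The backward escape function `G⁻(p) = lim d⁻ⁿ log⁺ ‖H⁻ⁿ(p)‖`. -/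
def Gminus (H : HenonMap) (p : ℂ × ℂ) : ℝ :=
  limUnder atTop fun n : ℕ => Real.log (max ‖H.invFun^[n] p‖ 1) / (H.deg : ℝ) ^ n

/-- `p` is a periodic saddle point: `H^k(p) = p` for some `k ≥ 1` and `D(H^k)_p` has
an eigenvalue of modulus `< 1` and an eigenvalue of modulus `> 1`. -/
def IsSaddlePeriodic (H : HenonMap) (p : ℂ × ℂ) : Prop :=
  ∃ k : ℕ, 1 ≤ k ∧ H.toFun^[k] p = p ∧
    ∃ (v₁ v₂ : ℂ × ℂ) (μ₁ μ₂ : ℂ), v₁ ≠ 0 ∧ v₂ ≠ 0 ∧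
      fderiv ℂ (H.toFun^[k]) p v₁ = μ₁ • v₁ ∧
      fderiv ℂ (H.toFun^[k]) p v₂ = μ₂ • v₂ ∧
      ‖μ₁‖ < 1 ∧ 1 < ‖μ₂‖

/-- `J*`: the closure of the set of periodic saddle points. -/
def Jstar (H : HenonMap) : Set (ℂ × ℂ) :=
  closure {p | IsSaddlePeriodic H p}

/-- The stable set of a point. -/
def Ws (H : HenonMap) (p : ℂ × ℂ) : Set (ℂ × ℂ) :=
  {x | Tendsto (fun n : ℕ => dist (H.toFun^[n] x) (H.toFun^[n] p)) atTop (𝓝 0)}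

/-- The unstable set of a point. -/
def Wu (H : HenonMap) (p : ℂ × ℂ) : Set (ℂ × ℂ) :=
  {x | Tendsto (fun n : ℕ => dist (H.invFun^[n] x) (H.invFun^[n] p)) atTop (𝓝 0)}

/-- The stable set of a set. -/
def WsSet (H : HenonMap) (S : Set (ℂ × ℂ)) : Set (ℂ × ℂ) :=
  {x | Tendsto (fun n : ℕ => infDist (H.toFun^[n] x) S) atTop (𝓝 0)}

/-- The unstable set of a set. -/
def WuSet (H : HenonMap) (S : Set (ℂ × ℂ)) : Set (ℂ × ℂ) :=
  {x | Tendsto (fun n : ℕ => infDist (H.invFun^[n] x) S) atTop (𝓝 0)}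

/-- The local stable set of size `ε`. -/
def WsLoc (H : HenonMap) (ε : ℝ) (p : ℂ × ℂ) : Set (ℂ × ℂ) :=
  {x | (∀ n : ℕ, dist (H.toFun^[n] x) (H.toFun^[n] p) ≤ ε) ∧
       Tendsto (fun n : ℕ => dist (H.toFun^[n] x) (H.toFun^[n] p)) atTop (𝓝 0)}

/-- The local unstable set of size `ε`. -/
def WuLoc (H : HenonMap) (ε : ℝ) (p : ℂ × ℂ) : Set (ℂ × ℂ) :=
  {x | (∀ n : ℕ, dist (H.invFun^[n] x) (H.invFun^[n] p) ≤ ε) ∧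
       Tendsto (fun n : ℕ => dist (H.invFun^[n] x) (H.invFun^[n] p)) atTop (𝓝 0)}

/-- A parametrization of the stable manifold of `p`: an injective holomorphic immersion
`Φ : ℂ → ℂ²` with `Φ(0) = p` and image `W^s_p`. -/
def IsStableParam (H : HenonMap) (p : ℂ × ℂ) (Φ : ℂ → ℂ × ℂ) : Prop :=
  Differentiable ℂ Φ ∧ Function.Injective Φ ∧ (∀ z, deriv Φ z ≠ 0) ∧
    Φ 0 = p ∧ Set.range Φ = Ws H p

/-- A parametrization of the unstable manifold of `p`. -/
def IsUnstableParam (H : HenonMap) (p : ℂ × ℂ) (Ψ : ℂ → ℂ × ℂ) : Prop :=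
  Differentiable ℂ Ψ ∧ Function.Injective Ψ ∧ (∀ z, deriv Ψ z ≠ 0) ∧
    Ψ 0 = p ∧ Set.range Ψ = Wu H p

/-- Uniform hyperbolicity of `H` on a compact completely invariant set `S`:
a continuous invariant splitting `ℂ² = E^s_x ⊕ E^u_x` into complex lines, with uniform
contraction on `E^s` and uniform expansion on `E^u`.  Continuity of the line fields is
expressed by the closedness of their total spaces over `S` (equivalent to continuity
for fields of lines of constant dimension over a compact set). -/
def UniformlyHyperbolicOn (H : HenonMap) (S : Set (ℂ × ℂ)) : Prop :=
  IsCompact S ∧ H.toFun '' S = S ∧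
  ∃ (Es Eu : (ℂ × ℂ) → Submodule ℂ (ℂ × ℂ)) (c lam : ℝ),
    0 < c ∧ 0 < lam ∧ lam < 1 ∧
    (∀ x ∈ S, Module.finrank ℂ (Es x) = 1) ∧
    (∀ x ∈ S, Module.finrank ℂ (Eu x) = 1) ∧
    (∀ x ∈ S, IsCompl (Es x) (Eu x)) ∧
    IsClosed {q : (ℂ × ℂ) × (ℂ × ℂ) | q.1 ∈ S ∧ q.2 ∈ Es q.1} ∧
    IsClosed {q : (ℂ × ℂ) × (ℂ × ℂ) | q.1 ∈ S ∧ q.2 ∈ Eu q.1} ∧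
    (∀ x ∈ S, (Es x).map (fderiv ℂ H.toFun x : (ℂ × ℂ) →ₗ[ℂ] (ℂ × ℂ)) = Es (H.toFun x)) ∧
    (∀ x ∈ S, (Eu x).map (fderiv ℂ H.toFun x : (ℂ × ℂ) →ₗ[ℂ] (ℂ × ℂ)) = Eu (H.toFun x)) ∧
    (∀ x ∈ S, ∀ v ∈ Es x, ∀ n : ℕ, 1 ≤ n →
      ‖fderiv ℂ (H.toFun^[n]) x v‖ ≤ (lam ^ n / c) * ‖v‖) ∧
    (∀ x ∈ S, ∀ v ∈ Eu x, ∀ n : ℕ, 1 ≤ n →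
      ‖fderiv ℂ (H.toFun^[n]) x v‖ ≥ (c / lam ^ n) * ‖v‖)

/-- `p ∈ J*` is weakly stably exposed: there are a parametrization `Φ` of `W^s_p` and a
nonempty simply connected open set `V ⊂ ℂ` with `0 ∈ ∂V`, `∂V ⊂ J*_{p,s}` and
`Φ(V) ⊂ K ∖ J*`. -/
def WeaklyStablyExposed (H : HenonMap) (p : ℂ × ℂ) : Prop :=
  ∃ (Φ : ℂ → ℂ × ℂ) (V : Set ℂ), IsStableParam H p Φ ∧
    V.Nonempty ∧ IsOpen V ∧ SimplyConnectedSpace V ∧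
    (0 : ℂ) ∈ frontier V ∧ frontier V ⊆ Φ ⁻¹' Jstar H ∧
    Φ '' V ⊆ (Kplus H ∩ Kminus H) \ Jstar H

/-- `p ∈ J*` is weakly unstably exposed. -/
def WeaklyUnstablyExposed (H : HenonMap) (p : ℂ × ℂ) : Prop :=
  ∃ (Ψ : ℂ → ℂ × ℂ) (V : Set ℂ), IsUnstableParam H p Ψ ∧
    V.Nonempty ∧ IsOpen V ∧ SimplyConnectedSpace V ∧
    (0 : ℂ) ∈ frontier V ∧ frontier V ⊆ Ψ ⁻¹' Jstar H ∧
    Ψ '' V ⊆ (Kplus H ∩ Kminus H) \ Jstar H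

/-- `F` is continuous, `ℓ ∘ F` is comparable to `d * ℓ` up to a bounded error on the forward
invariant set `S`, and `ℓ` grows by at most a bounded amount whenever `F` avoids `S`. -/
structure GrowsOn {X : Type*} [TopologicalSpace X] (ℓ : X → ℝ) (S : Set X) (F : X → X)
    (d C : ℝ) : Prop where
  continuous : Continuous F
  nonneg : 0 ≤ C
  mapsTo : ∀ p ∈ S, F p ∈ S
  lower : ∀ p ∈ S, d * ℓ p - C ≤ ℓ (F p)
  upper : ∀ p, ℓ (F p) ≤ d * ℓ p + C
  slow : ∀ p, F p ∉ S → ℓ (F p) ≤ ℓ p + C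

namespace GrowsOn

variable {X : Type*} [TopologicalSpace X] {ℓ : X → ℝ} {S : Set X} {F G : X → X} {d e C D : ℝ}

theorem id : GrowsOn ℓ S id 1 0 where
  continuous := continuous_id
  nonneg := le_rfl
  mapsTo _ h := h
  lower p _ := by simp
  upper p := by simp
  slow p _ := by simp

theorem comp (hF : GrowsOn ℓ S F d C) (hG : GrowsOn ℓ S G e D) (hd : 1 ≤ d) :
    GrowsOn ℓ S (F ∘ G) (d * e) (C + d * D) where
  continuous := hF.continuous.comp hG.continuous
  nonneg := add_nonneg hF.nonneg (mul_nonneg (by linarith) hG.nonneg)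
  mapsTo p hp := hF.mapsTo _ (hG.mapsTo p hp)
  lower p hp := by
    have h₁ := hF.lower _ (hG.mapsTo p hp)
    have h₂ := mul_le_mul_of_nonneg_left (hG.lower p hp) (by linarith : 0 ≤ d)
    simp only [Function.comp_apply]
    linarith
  upper p := by
    have h₁ := hF.upper (G p)
    have h₂ := mul_le_mul_of_nonneg_left (hG.upper p) (by linarith : 0 ≤ d)
    simp only [Function.comp_apply]
    linarith
  slow p hp := by
    have h₁ := hF.slow _ hp
    have h₂ := hG.slow p fun h => hp (hF.mapsTo _ h)
    have h₃ := mul_le_mul_of_nonneg_right hd hG.nonneg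
    simp only [Function.comp_apply]
    linarith

theorem le_add_of_iterate_notMem (hF : GrowsOn ℓ S F d C) (p : X) (n : ℕ)
    (hn : F^[n] p ∉ S) : ℓ (F^[n] p) ≤ ℓ p + C * n := by
  induction n with
  | zero => simp
  | succ n ih =>
    rw [Function.iterate_succ_apply'] at hn ⊢
    have h₁ := ih fun h => hn (hF.mapsTo _ h)
    have h₂ := hF.slow _ hn
    push_cast
    linarith

theorem abs_iterate_succ_sub_le (hF : GrowsOn ℓ S F d C) (hℓ : ∀ p, 0 ≤ ℓ p) (hd : 1 ≤ d)
    (p : X) (n : ℕ) :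
    |ℓ (F^[n + 1] p) - d * ℓ (F^[n] p)| ≤ d * (ℓ p + C * n + C) := by
  have hC := hF.nonneg
  have hCn : 0 ≤ C * n := by positivity
  have hdC : C ≤ d * C := by nlinarith
  have hp := hℓ p
  have hmul : d * (ℓ p + C * n + C) = d * (ℓ p + C * n) + d * C := by ring
  have hnn : 0 ≤ d * (ℓ p + C * n) := by positivity
  rw [Function.iterate_succ_apply', hmul, abs_le]
  have hup := hF.upper (F^[n] p)
  by_cases h : F^[n] p ∈ S
  · have hlow := hF.lower _ h
    constructor <;> linarith
  · have h₁ := mul_le_mul_of_nonneg_left (hF.le_add_of_iterate_notMem p n h)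
      (by linarith : 0 ≤ d)
    have h₂ := hℓ (F (F^[n] p))
    constructor <;> linarith

theorem exists_continuous_limit (hF : GrowsOn ℓ S F d C) (hℓ : ∀ p, 0 ≤ ℓ p)
    (hℓc : Continuous ℓ) (hd : 1 < d) :
    ∃ g : X → ℝ, Continuous g ∧
      ∀ p, Tendsto (fun n : ℕ => ℓ (F^[n] p) / d ^ n) atTop (𝓝 (g p)) := by
  have hd₀ : 0 < d := by linarith
  let t : ℕ → X → ℝ := fun n p => ℓ (F^[n + 1] p) / d ^ (n + 1) - ℓ (F^[n] p) / d ^ n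
  have ht : ∀ n p, |t n p| ≤ (ℓ p + C * n + C) / d ^ n := by
    intro n p
    have h : t n p = (ℓ (F^[n + 1] p) - d * ℓ (F^[n] p)) / d ^ (n + 1) := by
      simp only [t]
      field_simp
      ring
    rw [h, abs_div, abs_of_pos (pow_pos hd₀ _), div_le_div_iff₀ (by positivity) (by positivity)]
    calc _ ≤ d * (ℓ p + C * n + C) * d ^ n :=
          mul_le_mul_of_nonneg_right (hF.abs_iterate_succ_sub_le hℓ hd.le p n) (by positivity)
      _ = _ := by ring
  have hsum : ∀ A : ℝ, Summable fun n : ℕ => (A + C * n + C) / d ^ n := by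
    intro A
    have hr : ‖d⁻¹‖ < 1 := by
      rw [Real.norm_of_nonneg (by positivity)]
      exact inv_lt_one_of_one_lt₀ hd
    have h₁ := (summable_geometric_of_norm_lt_one hr).mul_left (A + C)
    have h₂ := (summable_pow_mul_geometric_of_norm_lt_one 1 hr).mul_left C
    refine (h₁.add h₂).congr fun n => ?_
    rw [inv_pow]
    field_simp
    ring
  have htc : ∀ n, Continuous (t n) := fun n =>
    ((hℓc.comp (hF.continuous.iterate _)).div_const _).sub
      ((hℓc.comp (hF.continuous.iterate _)).div_const _)
  refine ⟨fun p => ℓ p + ∑' n, t n p, hℓc.add ?_, fun p => ?_⟩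
  · rw [continuous_iff_continuousAt]
    intro p
    have hopen : IsOpen {q | ℓ q < ℓ p + 1} := isOpen_lt hℓc continuous_const
    refine ContinuousOn.continuousAt (s := {q | ℓ q < ℓ p + 1}) ?_
      (hopen.mem_nhds (by simp))
    refine continuousOn_tsum (fun n => (htc n).continuousOn) (hsum (ℓ p + 1)) ?_
    intro n q hq
    refine (ht n q).trans ?_
    have : ℓ q ≤ ℓ p + 1 := le_of_lt hq
    gcongr
  · have hs : Summable fun n => t n p :=
      Summable.of_norm_bounded (hsum (ℓ p)) fun n => ht n p
    refine (hs.hasSum.tendsto_sum_nat.const_add (ℓ p)).congr fun n => ?_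
    rw [Finset.sum_range_sub (fun n => ℓ (F^[n] p) / d ^ n)]
    simp

theorem conj {Y : Type*} [TopologicalSpace Y] {σ : Y ≃ₜ X} {m : Y → ℝ} (hF : GrowsOn ℓ S F d C)
    (hm : ∀ y, m y = ℓ (σ y)) : GrowsOn m (σ ⁻¹' S) (σ.symm ∘ F ∘ σ) d C where
  continuous := σ.symm.continuous.comp (hF.continuous.comp σ.continuous)
  nonneg := hF.nonneg
  mapsTo p hp := by simpa using hF.mapsTo _ hp
  lower p hp := by simpa [hm] using hF.lower _ hp
  upper p := by simpa [hm] using hF.upper (σ p)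
  slow p hp := by simpa [hm] using hF.slow (σ p) (by simpa using hp)

end GrowsOn

theorem Polynomial.norm_eval_le_mul_pow (P : Polynomial ℂ) {n : ℕ} (hn : P.natDegree ≤ n) :
    ∃ M : ℝ, 0 ≤ M ∧ ∀ (z : ℂ) (r : ℝ), 1 ≤ r → ‖z‖ ≤ r → ‖P.eval z‖ ≤ M * r ^ n := by
  refine ⟨∑ i ∈ Finset.range (P.natDegree + 1), ‖P.coeff i‖,
    Finset.sum_nonneg fun _ _ => norm_nonneg _, fun z r hr hz => ?_⟩
  rw [Polynomial.eval_eq_sum_range, Finset.sum_mul]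
  refine (norm_sum_le _ _).trans (Finset.sum_le_sum fun i hi => ?_)
  rw [norm_mul, norm_pow]
  have hi' : i ≤ n := (Nat.lt_succ_iff.mp (Finset.mem_range.mp hi)).trans hn
  gcongr
  exact (pow_le_pow_left₀ (norm_nonneg _) hz i).trans (pow_le_pow_right₀ hr hi')

/-- The function `log⁺ ‖p‖`. -/
def logPlusNorm (p : ℂ × ℂ) : ℝ := Real.log (max ‖p‖ 1)

theorem logPlusNorm_nonneg (p : ℂ × ℂ) : 0 ≤ logPlusNorm p :=
  Real.log_nonneg (le_max_right _ _)

theorem continuous_logPlusNorm : Continuous logPlusNorm :=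
  (continuous_norm.max continuous_const).log fun _ => by positivity

/-- The points whose first coordinate dominates both the second one and `R`. -/
def horizontalCone (R : ℝ) : Set (ℂ × ℂ) := {p | max ‖p.2‖ R ≤ ‖p.1‖}

theorem mem_horizontalCone {R : ℝ} {p : ℂ × ℂ} :
    p ∈ horizontalCone R ↔ ‖p.2‖ ≤ ‖p.1‖ ∧ R ≤ ‖p.1‖ := by
  simp [horizontalCone]

theorem ElemHenon.continuous_toFun (h : ElemHenon) : Continuous h.toFun := by
  unfold ElemHenon.toFun
  fun_prop

theorem logPlusNorm_le_of_norm_le {p q : ℂ × ℂ} {K : ℝ} {n : ℕ} (hK : 1 ≤ K)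
    (h : ‖q‖ ≤ K * max ‖p‖ 1 ^ n) : logPlusNorm q ≤ n * logPlusNorm p + Real.log K := by
  have hm : 1 ≤ max ‖p‖ 1 := le_max_right _ _
  have h₁ : max ‖q‖ 1 ≤ K * max ‖p‖ 1 ^ n :=
    max_le h (one_le_mul_of_one_le_of_one_le hK (one_le_pow₀ hm))
  have h₂ := Real.log_le_log (by positivity) h₁
  rw [Real.log_mul (by positivity) (by positivity), Real.log_pow] at h₂
  unfold logPlusNorm
  linarith

theorem ElemHenon.exists_upper (h : ElemHenon) :
    ∃ C : ℝ, ∀ p, logPlusNorm (h.toFun p) ≤ h.P.natDegree * logPlusNorm p + C := by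
  obtain ⟨M, hM, hMP⟩ := h.P.norm_eval_le_mul_pow le_rfl
  refine ⟨Real.log (M + ‖h.a‖ + ‖h.b‖ + 1), fun p => logPlusNorm_le_of_norm_le
    (by linarith [norm_nonneg h.a, norm_nonneg h.b]) ?_⟩
  set m := max ‖p‖ 1
  have hm : 1 ≤ m := le_max_right _ _
  have hpm : ‖p‖ ≤ m := le_max_left _ _
  have hmd : m ≤ m ^ h.P.natDegree := le_self_pow₀ hm (by have := h.hdeg; omega)
  have h₁ := hMP p.1 m hm ((norm_fst_le p).trans hpm)
  have ha : ‖h.a * p.2‖ ≤ ‖h.a‖ * m ^ h.P.natDegree := by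
    rw [norm_mul]
    exact mul_le_mul_of_nonneg_left (((norm_snd_le p).trans hpm).trans hmd) (norm_nonneg _)
  have hb : ‖h.b * p.1‖ ≤ ‖h.b‖ * m ^ h.P.natDegree := by
    rw [norm_mul]
    exact mul_le_mul_of_nonneg_left (((norm_fst_le p).trans hpm).trans hmd) (norm_nonneg _)
  have hpos : 0 ≤ m ^ h.P.natDegree := by positivity
  have hMm := mul_nonneg hM hpos
  have ham := mul_nonneg (norm_nonneg h.a) hpos
  have hbm := mul_nonneg (norm_nonneg h.b) hpos
  refine norm_prod_le_iff.mpr ⟨?_, ?_⟩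
  · have := norm_add_le (h.P.eval p.1) (h.a * p.2)
    simp only [ElemHenon.toFun]
    linarith
  · simp only [ElemHenon.toFun]
    linarith

theorem ElemHenon.slow (h : ElemHenon) {R : ℝ} (hR : 1 ≤ R) (p : ℂ × ℂ)
    (hp : h.toFun p ∉ horizontalCone R) :
    logPlusNorm (h.toFun p) ≤ logPlusNorm p + Real.log (‖h.b‖ + R) := by
  have hb := norm_nonneg h.b
  have key := logPlusNorm_le_of_norm_le (p := p) (q := h.toFun p) (K := ‖h.b‖ + R) (n := 1)
    (by linarith) ?_
  · simpa using key
  rw [pow_one]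
  set m := max ‖p‖ 1
  have hm : 1 ≤ m := le_max_right _ _
  have hpm : ‖p.1‖ ≤ m := (norm_fst_le p).trans (le_max_left _ _)
  have h₂ : ‖(h.toFun p).2‖ ≤ (‖h.b‖ + R) * m := by
    simp only [ElemHenon.toFun, norm_mul]
    nlinarith
  have h₃ : R ≤ (‖h.b‖ + R) * m := by nlinarith
  have h₁ : ‖(h.toFun p).1‖ < max ‖(h.toFun p).2‖ R := by
    simpa only [horizontalCone, Set.mem_ofPred_eq, not_le] using hp
  exact norm_prod_le_iff.mpr ⟨h₁.le.trans (max_le h₂ h₃), h₂⟩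

theorem ElemHenon.exists_lower (h : ElemHenon) :
    ∃ c : ℝ, 0 < c ∧ ∃ R₀ : ℝ, ∀ p : ℂ × ℂ, R₀ ≤ ‖p.1‖ → ‖p.2‖ ≤ ‖p.1‖ →
      c * ‖p.1‖ ^ h.P.natDegree ≤ ‖(h.toFun p).1‖ := by
  have hdeg := h.hdeg
  have hP : h.P ≠ 0 := by
    rintro h₀
    simp [h₀] at hdeg
  have hl : 0 < ‖h.P.leadingCoeff‖ := norm_pos_iff.mpr (by simpa using hP)
  obtain ⟨M, hM, hMP⟩ := h.P.eraseLead.norm_eval_le_mul_pow h.P.eraseLead_natDegree_le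
  set l := ‖h.P.leadingCoeff‖
  refine ⟨l / 2, by positivity, max 1 (2 * (M + ‖h.a‖) / l), fun p hR hp => ?_⟩
  set r := ‖p.1‖
  obtain ⟨k, hk⟩ : ∃ k, h.P.natDegree = k + 1 := ⟨h.P.natDegree - 1, by omega⟩
  have hr₁ : 1 ≤ r := (le_max_left _ _).trans hR
  have hr₂ : 2 * (M + ‖h.a‖) ≤ r * l := (div_le_iff₀ hl).mp ((le_max_right _ _).trans hR)
  have hrk : r ≤ r ^ k := le_self_pow₀ hr₁ (by omega)
  have hM' := hMP p.1 r hr₁ le_rfl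
  rw [hk, Nat.add_sub_cancel] at hM'
  have hsplit : h.P.eval p.1 + h.a * p.2 =
      h.P.leadingCoeff * p.1 ^ (k + 1) + (h.P.eraseLead.eval p.1 + h.a * p.2) := by
    conv_lhs => rw [← h.P.eraseLead_add_monomial_natDegree_leadingCoeff]
    rw [Polynomial.eval_add, Polynomial.eval_monomial, hk]
    ring
  have h₁ : ‖h.P.leadingCoeff * p.1 ^ (k + 1)‖ = l * r ^ (k + 1) := by
    rw [norm_mul, norm_pow]
  have h₂ : ‖h.P.eraseLead.eval p.1 + h.a * p.2‖ ≤ (M + ‖h.a‖) * r ^ k := by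
    refine (norm_add_le _ _).trans ?_
    rw [norm_mul, add_mul]
    gcongr
    exact hp.trans hrk
  have h₃ := norm_sub_le_norm_add (h.P.leadingCoeff * p.1 ^ (k + 1))
    (h.P.eraseLead.eval p.1 + h.a * p.2)
  have h₄ := mul_le_mul_of_nonneg_right hr₂ (by positivity : 0 ≤ r ^ k)
  simp only [ElemHenon.toFun]
  rw [hsplit, hk]
  have h₅ : r * l * r ^ k = l * r ^ (k + 1) := by ring
  linarith

theorem ElemHenon.eventually_growsOn (h : ElemHenon) :
    ∀ᶠ R in atTop, ∃ C, GrowsOn logPlusNorm (horizontalCone R) h.toFun h.P.natDegree C := by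
  obtain ⟨C, hC⟩ := h.exists_upper
  obtain ⟨c, hc, R₀, hlow⟩ := h.exists_lower
  filter_upwards [eventually_ge_atTop 1, eventually_ge_atTop R₀,
    eventually_ge_atTop (1 / c), eventually_ge_atTop (‖h.b‖ / c)] with R hR₁ hR₀ hRc hRb
  have hfst : ∀ p ∈ horizontalCone R, c * ‖p.1‖ ^ h.P.natDegree ≤ ‖(h.toFun p).1‖ :=
    fun p hp => hlow p (hR₀.trans (mem_horizontalCone.mp hp).2) (mem_horizontalCone.mp hp).1
  refine ⟨max (max C 0) (max (Real.log (‖h.b‖ + R)) (-Real.log c)), h.continuous_toFun,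
    (le_max_right _ _).trans (le_max_left _ _), fun p hp => ?_, fun p hp => ?_,
    fun p => (hC p).trans ?_, fun p hp => (h.slow hR₁ p hp).trans ?_⟩
  · have hR : R ≤ ‖p.1‖ := (mem_horizontalCone.mp hp).2
    have h₁ : 1 ≤ ‖p.1‖ * c := (div_le_iff₀ hc).mp (hRc.trans hR)
    have h₂ : ‖h.b‖ ≤ ‖p.1‖ * c := (div_le_iff₀ hc).mp (hRb.trans hR)
    have h₃ : ‖p.1‖ ^ 2 ≤ ‖p.1‖ ^ h.P.natDegree := pow_le_pow_right₀ (hR₁.trans hR) h.hdeg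
    have h₄ := mul_le_mul_of_nonneg_left h₃ hc.le
    have h₅ := hfst p hp
    refine mem_horizontalCone.mpr ⟨?_, ?_⟩
    · have : ‖(h.toFun p).2‖ = ‖h.b‖ * ‖p.1‖ := by simp [ElemHenon.toFun]
      nlinarith [norm_nonneg p.1]
    · nlinarith [norm_nonneg p.1]
  · have hR : R ≤ ‖p.1‖ := (mem_horizontalCone.mp hp).2
    have hpos : 0 < ‖p.1‖ := by linarith
    have hnorm : max ‖p‖ 1 = ‖p.1‖ := by
      rw [Prod.norm_def, max_eq_left (mem_horizontalCone.mp hp).1, max_eq_left (by linarith)]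
    have h₁ := Real.log_le_log (by positivity)
      ((hfst p hp).trans ((norm_fst_le _).trans (le_max_left _ 1)))
    rw [Real.log_mul (by positivity) (by positivity), Real.log_pow] at h₁
    have h₂ : -Real.log c ≤ max (max C 0) (max (Real.log (‖h.b‖ + R)) (-Real.log c)) :=
      (le_max_right _ _).trans (le_max_right _ _)
    simp only [logPlusNorm, hnorm] at h₁ ⊢
    linarith
  · gcongr
    exact (le_max_left _ _).trans (le_max_left _ _)
  · gcongr
    exact (le_max_left _ _).trans (le_max_right _ _)

/-- The elementary Hénon map conjugate to `h⁻¹` by the exchange of coordinates. -/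
def ElemHenon.swapInv (h : ElemHenon) : ElemHenon where
  P := Polynomial.C (-h.a⁻¹) * h.P.comp (Polynomial.C h.b⁻¹ * Polynomial.X)
  a := h.a⁻¹
  b := h.b⁻¹
  ha := inv_ne_zero h.ha
  hb := inv_ne_zero h.hb
  hdeg := by
    rw [Polynomial.natDegree_C_mul (neg_ne_zero.mpr (inv_ne_zero h.ha)),
      Polynomial.natDegree_comp, Polynomial.natDegree_C_mul_X _ (inv_ne_zero h.hb), mul_one]
    exact h.hdeg

theorem ElemHenon.natDegree_swapInv (h : ElemHenon) :
    h.swapInv.P.natDegree = h.P.natDegree := by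
  simp only [ElemHenon.swapInv]
  rw [Polynomial.natDegree_C_mul (neg_ne_zero.mpr (inv_ne_zero h.ha)),
    Polynomial.natDegree_comp, Polynomial.natDegree_C_mul_X _ (inv_ne_zero h.hb), mul_one]

theorem ElemHenon.invFun_eq_conj (h : ElemHenon) :
    h.invFun = (Homeomorph.prodComm ℂ ℂ).symm ∘ h.swapInv.toFun ∘ Homeomorph.prodComm ℂ ℂ := by
  funext p
  simp only [ElemHenon.invFun, ElemHenon.toFun, ElemHenon.swapInv, Function.comp_apply,
    Homeomorph.prodComm_symm, Homeomorph.coe_prodComm, Prod.fst_swap, Prod.snd_swap,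
    Prod.swap_prod_mk, Polynomial.eval_mul, Polynomial.eval_C, Polynomial.eval_comp,
    Polynomial.eval_X, div_eq_inv_mul]
  congr 1
  ring

theorem ElemHenon.eventually_growsOn_invFun (h : ElemHenon) :
    ∀ᶠ R in atTop, ∃ C, GrowsOn logPlusNorm (Homeomorph.prodComm ℂ ℂ ⁻¹' horizontalCone R)
      h.invFun h.P.natDegree C := by
  filter_upwards [h.swapInv.eventually_growsOn] with R ⟨C, hC⟩
  rw [h.invFun_eq_conj, ← h.natDegree_swapInv]
  exact ⟨C, hC.conj fun p => by simp [logPlusNorm, Prod.norm_def, max_comm]⟩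

theorem eventually_growsOn_foldr (L : List ElemHenon) :
    ∀ᶠ R in atTop, ∃ C, GrowsOn logPlusNorm (horizontalCone R)
      (L.foldr (fun h f => h.toFun ∘ f) id)
      ((L.map fun h => h.P.natDegree).prod : ℕ) C := by
  induction L with
  | nil => exact Eventually.of_forall fun R => ⟨0, by simpa using GrowsOn.id⟩
  | cons h L ih =>
    filter_upwards [ih, h.eventually_growsOn] with R ⟨C, hC⟩ ⟨D, hD⟩
    have hd : (1 : ℝ) ≤ h.P.natDegree := by exact_mod_cast one_le_two.trans h.hdeg
    refine ⟨D + h.P.natDegree * C, ?_⟩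
    simpa using hD.comp hC hd

theorem eventually_growsOn_foldl (L : List ElemHenon) (f : ℂ × ℂ → ℂ × ℂ) (d : ℕ)
    (hf : ∀ᶠ R in atTop, ∃ C, GrowsOn logPlusNorm
      (Homeomorph.prodComm ℂ ℂ ⁻¹' horizontalCone R) f d C) :
    ∀ᶠ R in atTop, ∃ C, GrowsOn logPlusNorm (Homeomorph.prodComm ℂ ℂ ⁻¹' horizontalCone R)
      (L.foldl (fun f h => h.invFun ∘ f) f)
      ((d * (L.map fun h => h.P.natDegree).prod : ℕ) : ℝ) C := by
  induction L generalizing f d with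
  | nil => simpa using hf
  | cons h L ih =>
    have hstep := ih (h.invFun ∘ f) (h.P.natDegree * d) <| by
      filter_upwards [hf, h.eventually_growsOn_invFun] with R ⟨C, hC⟩ ⟨D, hD⟩
      have hd : (1 : ℝ) ≤ h.P.natDegree := by exact_mod_cast one_le_two.trans h.hdeg
      exact ⟨_, by simpa using hD.comp hC hd⟩
    rw [List.foldl_cons, List.map_cons, List.prod_cons, ← mul_assoc, mul_comm d]
    exact hstep

theorem HenonMap.one_lt_deg (H : HenonMap) : 1 < H.deg := by
  obtain ⟨L, hL⟩ := H
  cases L with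
  | nil => exact absurd rfl hL
  | cons h L =>
    have hpos : 0 < (L.map fun h => h.P.natDegree).prod := by
      refine List.prod_pos fun x hx => ?_
      obtain ⟨g, -, rfl⟩ := List.mem_map.mp hx
      exact two_pos.trans_le g.hdeg
    simp only [HenonMap.deg, List.map_cons, List.prod_cons]
    nlinarith [h.hdeg]

/-- The limits defining `G⁺` and `G⁻` exist at every point and define continuous
functions `ℂ² → ℝ`. -/
theorem escape_functions_exist_and_continuous (H : HenonMap) :
    ∃ Gp Gm : ℂ × ℂ → ℝ, Continuous Gp ∧ Continuous Gm ∧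
      (∀ p : ℂ × ℂ,
        Tendsto (fun n : ℕ => Real.log (max ‖H.toFun^[n] p‖ 1) / (H.deg : ℝ) ^ n)
          atTop (𝓝 (Gp p))) ∧
      (∀ p : ℂ × ℂ,
        Tendsto (fun n : ℕ => Real.log (max ‖H.invFun^[n] p‖ 1) / (H.deg : ℝ) ^ n)
          atTop (𝓝 (Gm p))) := by
  have hd : (1 : ℝ) < H.deg := by exact_mod_cast H.one_lt_deg
  obtain ⟨R, C, hp⟩ := (eventually_growsOn_foldr H.comps).exists
  obtain ⟨R', C', hm⟩ := (eventually_growsOn_foldl H.comps id 1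
    (Eventually.of_forall fun R => ⟨0, by simpa using GrowsOn.id⟩)).exists
  rw [one_mul] at hm
  obtain ⟨Gp, hGp, hGp'⟩ :=
    hp.exists_continuous_limit logPlusNorm_nonneg continuous_logPlusNorm hd
  obtain ⟨Gm, hGm, hGm'⟩ :=
    hm.exists_continuous_limit logPlusNorm_nonneg continuous_logPlusNorm hd
  exact ⟨Gp, Gm, hGp, hGm, hGp', hGm'⟩


end
end

section
/- Let H be a complex Hénon map of degree d. The sets K⁺ and K⁻ are closed, the functions G⁺ and G⁻ are nonnegative, G⁺ vanishes on K⁺ and is strictly positive on ℂ² ∖ K⁺, and G⁻ vanishes on K⁻ and is strictly positive on ℂ² ∖ K⁻. -/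
open Filter Metric Topology Set

noncomputable section

/-- On the region `‖z‖ ≥ R`, `‖w‖ ≤ ‖z‖`, the map `f` preserves the cone `‖w‖ ≤ ‖z‖`, does not
decrease `‖z‖`, and acts on `log ‖z‖` as multiplication by `D` up to a bounded error. -/
def ConeGrowth (f : ℂ × ℂ → ℂ × ℂ) (D : ℕ) : Prop :=
  ∃ R K : ℝ, ∀ p : ℂ × ℂ, R ≤ ‖p.1‖ → ‖p.2‖ ≤ ‖p.1‖ →
    ‖(f p).2‖ ≤ ‖(f p).1‖ ∧ ‖p.1‖ ≤ ‖(f p).1‖ ∧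
      |Real.log ‖(f p).1‖ - D * Real.log ‖p.1‖| ≤ K

theorem ConeGrowth.id : ConeGrowth id 1 :=
  ⟨0, 0, fun p _ h => ⟨h, le_rfl, by simp⟩⟩

theorem ConeGrowth.comp {f g : ℂ × ℂ → ℂ × ℂ} {D E : ℕ} (hf : ConeGrowth f D)
    (hg : ConeGrowth g E) : ConeGrowth (f ∘ g) (D * E) := by
  obtain ⟨R, K, hf⟩ := hf
  obtain ⟨S, L, hg⟩ := hg
  refine ⟨max R S, K + D * L, fun p hp hc => ?_⟩
  obtain ⟨g1, g2, g3⟩ := hg p ((le_max_right _ _).trans hp) hc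
  obtain ⟨f1, f2, f3⟩ := hf (g p) (((le_max_left _ _).trans hp).trans g2) g1
  refine ⟨f1, g2.trans f2, ?_⟩
  have hD : (0 : ℝ) ≤ D := D.cast_nonneg
  rw [abs_le] at *
  have h1 := mul_le_mul_of_nonneg_left g3.1 hD
  have h2 := mul_le_mul_of_nonneg_left g3.2 hD
  push_cast
  simp only [Function.comp_apply]
  constructor <;> linarith

/-- A polynomial is asymptotic to its leading term at infinity. -/
theorem Polynomial.exists_norm_eval_sub_leadingTerm_le (P : Polynomial ℂ) {ε : ℝ} (hε : 0 < ε) :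
    ∃ R : ℝ, ∀ z : ℂ, R ≤ ‖z‖ →
      ‖P.eval z - P.leadingCoeff * z ^ P.natDegree‖ ≤ ε * ‖z‖ ^ P.natDegree := by
  have hcont : ContinuousAt (fun z : ℂ => P.reverse.eval z) 0 := P.reverse.continuous.continuousAt
  obtain ⟨δ, hδ, h⟩ := Metric.continuousAt_iff.1 hcont ε hε
  refine ⟨δ⁻¹ + 1, fun z hz => ?_⟩
  have hδ' : 0 < δ⁻¹ := inv_pos.2 hδ
  have hz0 : 0 < ‖z‖ := by linarith
  have hzne : z ≠ 0 := norm_pos_iff.1 hz0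
  have hinv : dist z⁻¹ 0 < δ := by
    rw [dist_zero_right, norm_inv]
    exact inv_lt_of_inv_lt₀ hδ (by linarith)
  have h2 := h hinv
  have h0 : P.reverse.eval 0 = P.leadingCoeff := by
    rw [← Polynomial.coeff_zero_eq_eval_zero, Polynomial.coeff_zero_reverse]
  have hP : P.eval z = P.reverse.eval z⁻¹ * z ^ P.natDegree := by
    let _ : Invertible z := invertibleOfNonzero hzne
    have := Polynomial.eval₂_reverse_mul_pow (RingHom.id ℂ) z P
    rw [invOf_eq_inv] at this
    exact this.symm
  rw [dist_eq_norm, h0] at h2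
  rw [hP, ← sub_mul, norm_mul, norm_pow]
  gcongr

theorem ElemHenon.coneGrowth (h : ElemHenon) : ConeGrowth h.toFun h.P.natDegree := by
  have hP : h.P ≠ 0 := by
    intro h0
    have := h.hdeg
    simp [h0] at this
  set c : ℝ := ‖h.P.leadingCoeff‖ with hc
  have hc0 : 0 < c := norm_pos_iff.2 (Polynomial.leadingCoeff_ne_zero.2 hP)
  obtain ⟨R, hR⟩ := h.P.exists_norm_eval_sub_leadingTerm_le (ε := c / 4) (by positivity)
  refine ⟨R ⊔ 1 ⊔ 4 * ‖h.a‖ / c ⊔ 2 / c ⊔ 2 * ‖h.b‖ / c,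
    |Real.log (c / 2)| + |Real.log (3 * c / 2)|, fun p hp hcone => ?_⟩
  simp only [sup_le_iff] at hp
  obtain ⟨⟨⟨⟨hp1, hp2⟩, hp3⟩, hp4⟩, hp5⟩ := hp
  rw [div_le_iff₀ hc0] at hp3 hp4 hp5
  set n := h.P.natDegree with hn
  set r := ‖p.1‖ with hr
  have hr0 : 0 < r := by linarith
  have hrn : r ^ 2 ≤ r ^ n := pow_le_pow_right₀ hp2 h.hdeg
  have hrn0 : 0 < r ^ n := by positivity
  have hclose : ‖(h.toFun p).1 - h.P.leadingCoeff * p.1 ^ n‖ ≤ c / 2 * r ^ n := by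
    have h1 : (h.toFun p).1 - h.P.leadingCoeff * p.1 ^ n
        = (h.P.eval p.1 - h.P.leadingCoeff * p.1 ^ n) + h.a * p.2 := by
      simp only [ElemHenon.toFun]; ring
    have h2 : ‖h.a * p.2‖ ≤ c / 4 * r ^ n := by
      rw [norm_mul]
      calc ‖h.a‖ * ‖p.2‖ ≤ ‖h.a‖ * r := by gcongr
        _ ≤ c / 4 * r ^ 2 := by nlinarith
        _ ≤ c / 4 * r ^ n := by gcongr
    rw [h1]
    refine (norm_add_le _ _).trans ?_
    have := hR p.1 hp1
    linarith
  have hlead : ‖h.P.leadingCoeff * p.1 ^ n‖ = c * r ^ n := by rw [norm_mul, norm_pow]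
  have hlow : c / 2 * r ^ n ≤ ‖(h.toFun p).1‖ := by
    have := norm_sub_norm_le (h.P.leadingCoeff * p.1 ^ n) (h.toFun p).1
    rw [norm_sub_rev] at this
    linarith
  have hup : ‖(h.toFun p).1‖ ≤ 3 * c / 2 * r ^ n := by
    have := norm_sub_norm_le (h.toFun p).1 (h.P.leadingCoeff * p.1 ^ n)
    linarith
  have hsq : c / 2 * r ^ 2 ≤ ‖(h.toFun p).1‖ := le_trans (by gcongr) hlow
  refine ⟨?_, ?_, ?_⟩
  · refine le_trans ?_ hsq
    simp only [ElemHenon.toFun, norm_mul]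
    nlinarith
  · refine le_trans ?_ hsq
    nlinarith
  · have l1 := Real.log_le_log (by positivity) hlow
    have l2 := Real.log_le_log (lt_of_lt_of_le (by positivity) hlow) hup
    rw [Real.log_mul (by positivity) (by positivity), Real.log_pow] at l1 l2
    have a1 := neg_abs_le (Real.log (c / 2))
    have a2 := le_abs_self (Real.log (3 * c / 2))
    have a3 := abs_nonneg (Real.log (c / 2))
    have a4 := abs_nonneg (Real.log (3 * c / 2))
    rw [abs_le]
    constructor <;> linarith

theorem HenonMap.coneGrowth (H : HenonMap) : ConeGrowth H.toFun H.deg := by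
  obtain ⟨l, hl⟩ := H
  simp only [HenonMap.toFun, HenonMap.deg]
  clear hl
  induction l with
  | nil => exact ConeGrowth.id
  | cons h l ih => exact h.coneGrowth.comp ih

theorem HenonMap.two_le_deg (H : HenonMap) : 2 ≤ H.deg := by
  obtain ⟨l, hl⟩ := H
  obtain ⟨h, l, rfl⟩ := List.exists_cons_of_ne_nil hl
  have hpos : 0 < (l.map fun h => h.P.natDegree).prod := by
    refine List.prod_pos fun n hn => ?_
    obtain ⟨g, -, rfl⟩ := List.mem_map.1 hn
    exact two_pos.trans_le g.hdeg
  simp only [HenonMap.deg, List.map_cons, List.prod_cons]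
  exact h.hdeg.trans (Nat.le_mul_of_pos_right _ hpos)

theorem HenonMap.continuous_toFun (H : HenonMap) : Continuous H.toFun := by
  obtain ⟨l, hl⟩ := H
  simp only [HenonMap.toFun]
  clear hl
  induction l with
  | nil => exact continuous_id
  | cons h l ih =>
    have := h.P.continuous
    have hh : Continuous h.toFun := by
      unfold ElemHenon.toFun
      fun_prop
    exact hh.comp ih

theorem ElemHenon.invFun_toFun (h : ElemHenon) (p : ℂ × ℂ) : h.invFun (h.toFun p) = p := by
  have := h.ha
  have := h.hb
  ext <;> simp [ElemHenon.invFun, ElemHenon.toFun, *]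

theorem HenonMap.invFun_toFun (H : HenonMap) (p : ℂ × ℂ) : H.invFun (H.toFun p) = p := by
  have key : ∀ (l : List ElemHenon) (f : ℂ × ℂ → ℂ × ℂ) (q x : ℂ × ℂ),
      f q = l.foldr (fun h f => h.toFun ∘ f) id x →
        l.foldl (fun f h => h.invFun ∘ f) f q = x := by
    intro l
    induction l with
    | nil => exact fun f q x hx => hx
    | cons h l ih =>
      intro f q x hx
      refine ih (h.invFun ∘ f) q x ?_
      rw [Function.comp_apply, hx]
      exact h.invFun_toFun _
  exact key H.comps id _ p rfl

/-- The elementary Hénon map conjugate to the inverse of `h` by the coordinate swap. -/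
def ElemHenon.dual (h : ElemHenon) : ElemHenon where
  P := Polynomial.C (-h.a⁻¹) * h.P.comp (Polynomial.C h.b⁻¹ * Polynomial.X)
  a := h.a⁻¹
  b := h.b⁻¹
  ha := inv_ne_zero h.ha
  hb := inv_ne_zero h.hb
  hdeg := by
    rw [Polynomial.natDegree_C_mul (neg_ne_zero.2 (inv_ne_zero h.ha)), Polynomial.natDegree_comp,
      Polynomial.natDegree_C_mul_X _ (inv_ne_zero h.hb), mul_one]
    exact h.hdeg

theorem ElemHenon.natDegree_dual (h : ElemHenon) : h.dual.P.natDegree = h.P.natDegree := by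
  simp only [ElemHenon.dual]
  rw [Polynomial.natDegree_C_mul (neg_ne_zero.2 (inv_ne_zero h.ha)), Polynomial.natDegree_comp,
    Polynomial.natDegree_C_mul_X _ (inv_ne_zero h.hb), mul_one]

theorem ElemHenon.dual_toFun_swap (h : ElemHenon) (p : ℂ × ℂ) :
    h.dual.toFun p.swap = (h.invFun p).swap := by
  ext
  · simp [ElemHenon.dual, ElemHenon.toFun, ElemHenon.invFun, div_eq_inv_mul]
    ring
  · simp [ElemHenon.dual, ElemHenon.toFun, ElemHenon.invFun, div_eq_inv_mul]

/-- The Hénon map conjugate to the inverse of `H` by the coordinate swap. -/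
def HenonMap.dual (H : HenonMap) : HenonMap where
  comps := (H.comps.map ElemHenon.dual).reverse
  ne := by simpa using H.ne

theorem HenonMap.deg_dual (H : HenonMap) : H.dual.deg = H.deg := by
  simp [HenonMap.deg, HenonMap.dual, List.prod_reverse, Function.comp_def,
    ElemHenon.natDegree_dual]

theorem HenonMap.dual_toFun_swap (H : HenonMap) (p : ℂ × ℂ) :
    H.dual.toFun p.swap = (H.invFun p).swap := by
  have key : ∀ (l : List ElemHenon) (f g : ℂ × ℂ → ℂ × ℂ), (∀ q, g q.swap = (f q).swap) →
      ∀ q, (l.map ElemHenon.dual).foldl (fun f h => h.toFun ∘ f) g q.swap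
        = (l.foldl (fun f h => h.invFun ∘ f) f q).swap := by
    intro l
    induction l with
    | nil => exact fun f g hfg => hfg
    | cons h l ih =>
      intro f g hfg
      refine ih (h.invFun ∘ f) (h.dual.toFun ∘ g) fun q => ?_
      simp only [Function.comp_apply, hfg, h.dual_toFun_swap]
  simp only [HenonMap.toFun, HenonMap.dual, List.foldr_reverse]
  exact key H.comps id id (fun _ => rfl) p

theorem HenonMap.dual_iterate_swap (H : HenonMap) (n : ℕ) (p : ℂ × ℂ) :
    H.dual.toFun^[n] p.swap = (H.invFun^[n] p).swap := by
  have hs : Function.Semiconj Prod.swap H.invFun H.dual.toFun :=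
    fun q => (H.dual_toFun_swap q).symm
  exact (hs.iterate_right n p).symm

theorem Prod.norm_swap {E F : Type*} [Norm E] [Norm F] (p : E × F) : ‖p.swap‖ = ‖p‖ :=
  max_comm _ _

/-- A real sequence satisfying `a (n + 1) = d * a n + O(1)` that starts above the error bound
grows like `dⁿ`. -/
theorem exists_pos_tendsto_div_pow {a : ℕ → ℝ} {d K : ℝ} (hd : 2 ≤ d)
    (ha : ∀ n, |a (n + 1) - d * a n| ≤ K) (h0 : K < a 0) :
    ∃ L, 0 < L ∧ Tendsto (fun n => a n / d ^ n) atTop (𝓝 L) := by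
  have hd0 : 0 < d := by linarith
  have hK : 0 ≤ K := (abs_nonneg _).trans (ha 0)
  have hcauchy : CauchySeq fun n => a n / d ^ n := by
    refine cauchySeq_of_le_geometric d⁻¹ (K / d) (inv_lt_one_of_one_lt₀ (by linarith)) fun n => ?_
    have : a n / d ^ n - a (n + 1) / d ^ (n + 1) = -(a (n + 1) - d * a n) / d ^ (n + 1) := by
      field_simp
      ring
    rw [Real.dist_eq, this, abs_div, abs_neg, abs_of_pos (pow_pos hd0 (n + 1))]
    calc _ ≤ K / d ^ (n + 1) := by gcongr; exact ha n
      _ = K / d * d⁻¹ ^ n := by rw [inv_pow]; field_simp; ring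
  obtain ⟨L, hL⟩ := cauchySeq_tendsto_of_complete hcauchy
  have hlow : ∀ n, (a 0 - K) * d ^ n ≤ a n - K := by
    intro n
    induction n with
    | zero => simp
    | succ n ih =>
      have h1 := (abs_le.1 (ha n)).1
      have h2 := mul_le_mul_of_nonneg_left ih hd0.le
      rw [pow_succ]
      nlinarith
  refine ⟨L, lt_of_lt_of_le (sub_pos.2 h0) (ge_of_tendsto' hL fun n => ?_), hL⟩
  rw [le_div_iff₀ (pow_pos hd0 n)]
  linarith [hlow n]

namespace HenonMap

/-- Once an orbit enters the cone region, the escape rate exists and is positive. -/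
theorem exists_pos_tendsto_of_mem_cone (H : HenonMap) {R K : ℝ} (hR : 1 ≤ R)
    (hRK : K < Real.log R)
    (hf : ∀ p : ℂ × ℂ, R ≤ ‖p.1‖ → ‖p.2‖ ≤ ‖p.1‖ →
      ‖(H.toFun p).2‖ ≤ ‖(H.toFun p).1‖ ∧ ‖p.1‖ ≤ ‖(H.toFun p).1‖ ∧
        |Real.log ‖(H.toFun p).1‖ - H.deg * Real.log ‖p.1‖| ≤ K)
    {p : ℂ × ℂ} {N : ℕ} (h1 : R ≤ ‖(H.toFun^[N] p).1‖)
    (h2 : ‖(H.toFun^[N] p).2‖ ≤ ‖(H.toFun^[N] p).1‖) :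
    ∃ L, 0 < L ∧ Tendsto (fun n : ℕ => Real.log (max ‖H.toFun^[n] p‖ 1) / (H.deg : ℝ) ^ n)
      atTop (𝓝 L) := by
  have hd : (2 : ℝ) ≤ H.deg := by exact_mod_cast H.two_le_deg
  have hmem : ∀ n, R ≤ ‖(H.toFun^[n + N] p).1‖ ∧
      ‖(H.toFun^[n + N] p).2‖ ≤ ‖(H.toFun^[n + N] p).1‖ := by
    intro n
    induction n with
    | zero => simpa using ⟨h1, h2⟩
    | succ n ih =>
      rw [Nat.succ_add, Function.iterate_succ_apply']
      obtain ⟨c1, c2, -⟩ := hf _ ih.1 ih.2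
      exact ⟨ih.1.trans c2, c1⟩
  obtain ⟨L, hL0, hL⟩ := exists_pos_tendsto_div_pow
    (a := fun n => Real.log ‖(H.toFun^[n + N] p).1‖) (K := K) hd
    (fun n => by
      rw [Nat.succ_add, Function.iterate_succ_apply']
      exact (hf _ (hmem n).1 (hmem n).2).2.2)
    (hRK.trans_le (Real.log_le_log (by linarith) (hmem 0).1))
  have hdN : (0 : ℝ) < (H.deg : ℝ) ^ N := by positivity
  refine ⟨L / (H.deg : ℝ) ^ N, div_pos hL0 hdN, ?_⟩
  rw [← tendsto_add_atTop_iff_nat N]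
  refine (hL.div_const _).congr fun n => ?_
  have hnorm : max ‖H.toFun^[n + N] p‖ 1 = ‖(H.toFun^[n + N] p).1‖ := by
    rw [Prod.norm_def, max_eq_left (hmem n).2, max_eq_left (hR.trans (hmem n).1)]
  rw [hnorm, pow_add, div_div]

theorem mem_Kplus_iff (H : HenonMap) (p : ℂ × ℂ) :
    p ∈ Kplus H ↔ ∃ C, ∀ n : ℕ, ‖H.toFun^[n] p‖ ≤ C := by
  simp only [Kplus, mem_ofPred_eq, isBounded_iff_forall_norm_le, forall_mem_range]

theorem tendsto_zero_of_mem_Kplus (H : HenonMap) {p : ℂ × ℂ} (hp : p ∈ Kplus H) :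
    Tendsto (fun n : ℕ => Real.log (max ‖H.toFun^[n] p‖ 1) / (H.deg : ℝ) ^ n) atTop (𝓝 0) := by
  have hd : (1 : ℝ) < H.deg := by exact_mod_cast H.two_le_deg
  obtain ⟨C, hC⟩ := (H.mem_Kplus_iff p).1 hp
  refine squeeze_zero (fun n => ?_) (fun n => ?_)
    ((tendsto_const_nhds (x := Real.log (max C 1))).div_atTop
    (tendsto_pow_atTop_atTop_of_one_lt hd))
  · exact div_nonneg (Real.log_nonneg (le_max_right _ _)) (by positivity)
  · gcongr
    exact hC n

/-- An orbit point outside the forward cone cannot be larger than both `R` and the starting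
point, since the inverse map is expanding on the complementary cone. -/
theorem norm_iterate_le (H : HenonMap) {R : ℝ}
    (hg : ∀ p : ℂ × ℂ, R ≤ ‖p.1‖ → ‖p.2‖ ≤ ‖p.1‖ →
      ‖(H.dual.toFun p).2‖ ≤ ‖(H.dual.toFun p).1‖ ∧ ‖p.1‖ ≤ ‖(H.dual.toFun p).1‖)
    {p : ℂ × ℂ} {n : ℕ}
    (h : ¬(R ≤ ‖(H.toFun^[n] p).1‖ ∧ ‖(H.toFun^[n] p).2‖ ≤ ‖(H.toFun^[n] p).1‖)) :
    ‖H.toFun^[n] p‖ ≤ max R ‖p‖ := by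
  have key : ∀ (n : ℕ) (p : ℂ × ℂ), R ≤ ‖(H.toFun^[n] p).2‖ →
      ‖(H.toFun^[n] p).1‖ ≤ ‖(H.toFun^[n] p).2‖ → ‖(H.toFun^[n] p).2‖ ≤ ‖p‖ := by
    intro n
    induction n with
    | zero => exact fun p _ _ => norm_snd_le p
    | succ n ih =>
      intro p h1 h2
      rw [Function.iterate_succ_apply'] at h1 h2 ⊢
      obtain ⟨c1, c2⟩ := hg (H.toFun (H.toFun^[n] p)).swap h1 h2
      rw [H.dual_toFun_swap, H.invFun_toFun] at c1 c2
      exact c2.trans (ih p (h1.trans c2) c1)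
  by_contra! hlt
  obtain ⟨hR, hp⟩ := max_lt_iff.1 hlt
  rw [Prod.norm_def (H.toFun^[n] p)] at hR hp
  rcases le_total ‖(H.toFun^[n] p).2‖ ‖(H.toFun^[n] p).1‖ with hle | hle
  · rw [max_eq_left hle] at hR
    exact h ⟨hR.le, hle⟩
  · rw [max_eq_right hle] at hR hp
    exact absurd (key n p hR.le hle) hp.not_ge

theorem isClosed_Kplus_and_escape (H : HenonMap) :
    IsClosed (Kplus H) ∧ ∀ p ∉ Kplus H, ∃ L, 0 < L ∧
      Tendsto (fun n : ℕ => Real.log (max ‖H.toFun^[n] p‖ 1) / (H.deg : ℝ) ^ n) atTop (𝓝 L) := by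
  obtain ⟨R₁, K, hf⟩ := H.coneGrowth
  obtain ⟨R₂, _, hg⟩ := H.dual.coneGrowth
  set R := R₁ ⊔ R₂ ⊔ 1 ⊔ Real.exp (K + 1) with hRdef
  have hR1 : R₁ ≤ R := le_sup_left.trans (le_sup_left.trans le_sup_left)
  have hR2 : R₂ ≤ R := le_sup_right.trans (le_sup_left.trans le_sup_left)
  have hR : 1 ≤ R := le_sup_right.trans le_sup_left
  have hRK : K < Real.log R := by
    have : K + 1 ≤ Real.log R := (Real.le_log_iff_exp_le (by linarith)).2 le_sup_right
    linarith
  have hesc : ∀ p N, R ≤ ‖(H.toFun^[N] p).1‖ →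
      ‖(H.toFun^[N] p).2‖ ≤ ‖(H.toFun^[N] p).1‖ → _ := fun p N =>
    H.exists_pos_tendsto_of_mem_cone hR hRK (fun p hp => hf p (hR1.trans hp)) (p := p) (N := N)
  have hbdd : ∀ p n, ¬(R ≤ ‖(H.toFun^[n] p).1‖ ∧
      ‖(H.toFun^[n] p).2‖ ≤ ‖(H.toFun^[n] p).1‖) → ‖H.toFun^[n] p‖ ≤ max R ‖p‖ := fun p n =>
    H.norm_iterate_le fun p hp hc =>
      ⟨(hg p (hR2.trans hp) hc).1, (hg p (hR2.trans hp) hc).2.1⟩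
  have hmem : ∀ p, (∀ n, ‖H.toFun^[n] p‖ ≤ max R ‖p‖) → p ∈ Kplus H := fun p hp =>
    (H.mem_Kplus_iff p).2 ⟨_, hp⟩
  refine ⟨?_, fun p hp => ?_⟩
  · have hK : Kplus H = ⋂ n : ℕ, {p | ‖H.toFun^[n] p‖ ≤ max R ‖p‖} := by
      ext p
      simp only [mem_iInter, mem_ofPred_eq]
      refine ⟨fun hp n => hbdd p n fun hcone => ?_, hmem p⟩
      obtain ⟨L, hL0, hL⟩ := hesc p n hcone.1 hcone.2
      exact hL0.ne' (tendsto_nhds_unique hL (H.tendsto_zero_of_mem_Kplus hp))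
    rw [hK]
    exact isClosed_iInter fun n => isClosed_le (H.continuous_toFun.iterate n).norm
      (continuous_const.max continuous_norm)
  · by_contra hno
    exact hp (hmem p fun n => hbdd p n fun hcone => hno (hesc p n hcone.1 hcone.2))

theorem Gplus_eq_zero (H : HenonMap) {p : ℂ × ℂ} (hp : p ∈ Kplus H) : Gplus H p = 0 :=
  (H.tendsto_zero_of_mem_Kplus hp).limUnder_eq

theorem Gplus_pos (H : HenonMap) {p : ℂ × ℂ} (hp : p ∉ Kplus H) : 0 < Gplus H p := by
  obtain ⟨L, hL0, hL⟩ := H.isClosed_Kplus_and_escape.2 p hp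
  rw [Gplus, hL.limUnder_eq]
  exact hL0

theorem Gplus_nonneg (H : HenonMap) (p : ℂ × ℂ) : 0 ≤ Gplus H p := by
  by_cases hp : p ∈ Kplus H
  · exact (H.Gplus_eq_zero hp).ge
  · exact (H.Gplus_pos hp).le

theorem mem_Kminus_iff (H : HenonMap) (p : ℂ × ℂ) : p ∈ Kminus H ↔ p.swap ∈ Kplus H.dual := by
  simp only [mem_Kplus_iff, Kminus, mem_ofPred_eq, isBounded_iff_forall_norm_le, forall_mem_range,
    H.dual_iterate_swap, Prod.norm_swap]

theorem Gminus_eq (H : HenonMap) (p : ℂ × ℂ) : Gminus H p = Gplus H.dual p.swap := by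
  simp only [Gminus, Gplus, H.dual_iterate_swap, Prod.norm_swap, H.deg_dual]

end HenonMap

/-- `K⁺` and `K⁻` are closed; `G⁺`, `G⁻` are nonnegative, vanish on `K⁺` (resp. `K⁻`)
and are strictly positive off `K⁺` (resp. `K⁻`). -/
theorem K_closed_and_G_sign_properties (H : HenonMap) :
    IsClosed (Kplus H) ∧ IsClosed (Kminus H) ∧
    (∀ p : ℂ × ℂ, 0 ≤ Gplus H p) ∧ (∀ p : ℂ × ℂ, 0 ≤ Gminus H p) ∧
    (∀ p ∈ Kplus H, Gplus H p = 0) ∧ (∀ p ∉ Kplus H, 0 < Gplus H p) ∧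
    (∀ p ∈ Kminus H, Gminus H p = 0) ∧ (∀ p ∉ Kminus H, 0 < Gminus H p) := by
  refine ⟨H.isClosed_Kplus_and_escape.1, ?_, H.Gplus_nonneg, fun p => ?_,
    fun p => H.Gplus_eq_zero, fun p => H.Gplus_pos, fun p hp => ?_, fun p hp => ?_⟩
  · have hK : Kminus H = Prod.swap ⁻¹' Kplus H.dual := Set.ext H.mem_Kminus_iff
    rw [hK]
    exact H.dual.isClosed_Kplus_and_escape.1.preimage continuous_swap
  · rw [H.Gminus_eq]
    exact H.dual.Gplus_nonneg _
  · rw [H.Gminus_eq]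
    exact H.dual.Gplus_eq_zero ((H.mem_Kminus_iff p).1 hp)
  · rw [H.Gminus_eq]
    exact H.dual.Gplus_pos (mt (H.mem_Kminus_iff p).2 hp)

end
end
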